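/- Let d ≥ 2 be an integer. There exists a constant c_d > 0, depending only on d, such that for every ε with 0 < ε < (8d)^{−2} the following holds. Let ρ = ⌈1/(8d·√ε)⌉, and let S = S₀ ∪ S₁ where S₀ = (ρ^{−1}·ℤ^d) ∩ ([0,1]^{d−1} × {0}) and S₁ = (ρ^{−1}·ℤ^d) ∩ ([0,1]^{d−1} × {1}). Then every Euclidean Steiner (1+ε)-spanner N = (V, E) for S whose vertex set satisfies V ⊆ [0,1]^d has at least c_d · ε^{(1−d)/2} · |S| edges; that is, the sparsity of N is at least c_d · ε^{(1−d)/2}. -/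

import Mathlib

open scoped RealInnerProductSpace

noncomputable section

/-- The grid `(ρ⁻¹·ℤ^d) ∩ ([0,1]^{d-1} × {c})`. -/
def gridSet (d : ℕ) (ρ : ℕ) (c : ℝ) : Set (EuclideanSpace ℝ (Fin d)) :=
  {p | ∀ i : Fin d, (∃ z : ℤ, p i = (z : ℝ) / (ρ : ℝ)) ∧
      ((i : ℕ) < d - 1 → 0 ≤ p i ∧ p i ≤ 1) ∧ ((i : ℕ) = d - 1 → p i = c)}

/-- `N = (V, E)` is a Euclidean Steiner `(1+ε)`-spanner for `S`. -/
def IsSteinerSpanner {d : ℕ} (ε : ℝ) (S : Set (EuclideanSpace ℝ (Fin d)))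
    (V : Finset (EuclideanSpace ℝ (Fin d)))
    (E : Finset (Sym2 (EuclideanSpace ℝ (Fin d)))) : Prop :=
  S ⊆ ↑V ∧
  (∀ e ∈ E, ¬ e.IsDiag ∧ ∀ p ∈ e, p ∈ V) ∧
  ∀ a ∈ S, ∀ b ∈ S, ∃ (m : ℕ) (v : ℕ → EuclideanSpace ℝ (Fin d)),
    v 0 = a ∧ v m = b ∧ (∀ i < m, s(v i, v (i + 1)) ∈ E) ∧
    ∑ i ∈ Finset.range m, ‖v (i + 1) - v i‖ ≤ (1 + ε) * ‖a - b‖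

/-- The two parts into which a vertex cuts a path are at least as long as the straight segments. -/
lemma norm_sub_add_norm_sub_le_sum {F : Type*} [SeminormedAddCommGroup F] (v : ℕ → F)
    {i m : ℕ} (hi : i ≤ m) :
    ‖v i - v 0‖ + ‖v m - v i‖ ≤ ∑ j ∈ Finset.range m, ‖v (j + 1) - v j‖ := by
  rw [← Finset.sum_range_add_sum_Ico _ hi, ← Finset.sum_range_sub v i, ← Finset.sum_Ico_sub v hi]
  exact add_le_add (norm_sum_le _ _) (norm_sum_le _ _)

section SteinerSpanner

variable {F : Type*} [NormedAddCommGroup F] [InnerProductSpace ℝ F]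

/-- Pythagoras for the component of `x` orthogonal to `s`. -/
lemma norm_sub_proj_sq (x s : F) (hs : s ≠ 0) :
    ‖x - (⟪x, s⟫ / ‖s‖ ^ 2) • s‖ ^ 2 = ‖x‖ ^ 2 - (⟪x, s⟫ / ‖s‖ ^ 2) ^ 2 * ‖s‖ ^ 2 := by
  have hs' : ‖s‖ ≠ 0 := norm_ne_zero_iff.mpr hs
  rw [norm_sub_sq_real, real_inner_smul_right, norm_smul, mul_pow, Real.norm_eq_abs, sq_abs]
  field_simp
  ring

/-- A vector nearly as long as its component along `s` is nearly parallel to `s`. -/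
lemma exists_norm_sub_smul_le_of_mul_norm_le_inner {ε : ℝ} (hε : 0 < ε) (hε1 : ε ≤ 1) {w s : F}
    (hs : s ≠ 0) (hw : w ≠ 0) (h : ‖w‖ * ‖s‖ ≤ (1 + ε) * ⟪w, s⟫) :
    ∃ r : ℝ, 0 < r ∧ ‖w - r • s‖ ≤ 2 * √ε * ‖s‖ * r := by
  have hs' : 0 < ‖s‖ := norm_pos_iff.mpr hs
  have hw' : 0 < ‖w‖ := norm_pos_iff.mpr hw
  have hin : 0 < ⟪w, s⟫ := by
    have : 0 < (1 + ε) * ⟪w, s⟫ := lt_of_lt_of_le (by positivity) h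
    exact pos_of_mul_pos_right this (by positivity)
  set r := ⟪w, s⟫ / ‖s‖ ^ 2 with hr
  have hr0 : 0 < r := by positivity
  refine ⟨r, hr0, ?_⟩
  have hwr : ‖w‖ ≤ (1 + ε) * (r * ‖s‖) := by
    have : (1 + ε) * (r * ‖s‖) = (1 + ε) * ⟪w, s⟫ / ‖s‖ := by
      rw [hr]; field_simp
    rw [this, le_div_iff₀ hs']
    exact h
  have hsq : ‖w‖ ^ 2 ≤ ((1 + ε) * (r * ‖s‖)) ^ 2 := by gcongr
  have hp := norm_sub_proj_sq w s hs
  rw [← hr] at hp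
  refine (sq_le_sq₀ (by positivity) (by positivity)).mp ?_
  have h2 : (2 * √ε * ‖s‖ * r) ^ 2 = 4 * ε * (r * ‖s‖) ^ 2 := by
    rw [mul_pow, mul_pow, mul_pow, Real.sq_sqrt hε.le]; ring
  rw [hp, h2]
  nlinarith [mul_nonneg (mul_nonneg hε.le (sub_nonneg.mpr hε1)) (sq_nonneg (r * ‖s‖)),
    mul_nonneg hε.le (sq_nonneg (r * ‖s‖))]

/-- The ellipsoid with foci `0` and `p + q` lies close to the line spanned by `p + q`. -/
lemma exists_norm_sub_smul_le_of_norm_add_norm_le {ε : ℝ} (hε : 0 < ε) (hε1 : ε ≤ 1) {p q s : F}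
    (hs : s ≠ 0) (hpq : p + q = s) (h : ‖p‖ + ‖q‖ ≤ (1 + ε) * ‖s‖) :
    ∃ r : ℝ, ‖p - r • s‖ ≤ √ε * ‖s‖ := by
  have hs' : 0 < ‖s‖ := norm_pos_iff.mpr hs
  set r := ⟪p, s⟫ / ‖s‖ ^ 2 with hr
  refine ⟨r, ?_⟩
  set k := p - r • s with hk
  have horth : ⟪s, k⟫ = 0 := by
    rw [hk, inner_sub_right, real_inner_smul_right, real_inner_self_eq_norm_sq,
      real_inner_comm, hr]
    field_simp
    ring
  have hp : p = r • s + k := by rw [hk]; abel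
  have hq : q = (1 - r) • s - k := by
    rw [hk, sub_smul, one_smul, sub_sub_sub_cancel_right, eq_sub_iff_add_eq', hpq]
  have hrefl : ‖(1 - r) • s + k‖ = ‖q‖ := by
    refine (sq_eq_sq₀ (norm_nonneg _) (norm_nonneg _)).mp ?_
    rw [hq, norm_add_sq_real, norm_sub_sq_real _ k, real_inner_smul_left, horth]
    ring
  have hsum : ‖s + (2 : ℝ) • k‖ ≤ (1 + ε) * ‖s‖ := by
    have : s + (2 : ℝ) • k = p + ((1 - r) • s + k) := by
      rw [hp]; module
    rw [this]
    refine (norm_add_le _ _).trans ?_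
    rw [hrefl]
    exact h
  have hsq : ‖s + (2 : ℝ) • k‖ ^ 2 ≤ ((1 + ε) * ‖s‖) ^ 2 := by gcongr
  rw [norm_add_sq_real, real_inner_smul_right, horth, norm_smul, Real.norm_eq_abs,
    abs_of_pos (by norm_num : (0 : ℝ) < 2)] at hsq
  refine (sq_le_sq₀ (by positivity) (by positivity)).mp ?_
  rw [mul_pow, Real.sq_sqrt hε.le]
  nlinarith [mul_nonneg (mul_nonneg hε.le (sub_nonneg.mpr hε1)) (sq_nonneg ‖s‖),
    mul_nonneg hε.le (sq_nonneg ‖s‖)]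

/-- A short path from `a` to `b` has a step that runs nearly in the direction `b - a`. -/
lemma exists_step_mul_norm_le_inner {ε : ℝ} {a b : F} (hab : a ≠ b) {m : ℕ} {v : ℕ → F}
    (h0 : v 0 = a) (hm : v m = b)
    (h : ∑ i ∈ Finset.range m, ‖v (i + 1) - v i‖ ≤ (1 + ε) * ‖b - a‖) :
    ∃ i < m, ‖v (i + 1) - v i‖ * ‖b - a‖ ≤ (1 + ε) * ⟪v (i + 1) - v i, b - a⟫ := by
  have hne : (Finset.range m).Nonempty := by
    rw [Finset.nonempty_range_iff]
    rintro rfl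
    exact hab (h0.symm.trans hm)
  have key : ∑ i ∈ Finset.range m, ‖v (i + 1) - v i‖ * ‖b - a‖ ≤
      ∑ i ∈ Finset.range m, (1 + ε) * ⟪v (i + 1) - v i, b - a⟫ := by
    rw [← Finset.sum_mul, ← Finset.mul_sum, ← sum_inner, Finset.sum_range_sub, h0, hm,
      real_inner_self_eq_norm_sq, sq, ← mul_assoc]
    gcongr
  obtain ⟨i, hi, hle⟩ := Finset.exists_le_of_sum_le hne key
  exact ⟨i, Finset.mem_range.mp hi, hle⟩

end SteinerSpanner

/-- Up to an error proportional to `√ε`, one edge of a `(1+ε)`-short path determines both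
endpoints of the path, where these lie on opposite facets of the unit cube. -/
lemma exists_edge_near_endpoints {n : ℕ} {ε : ℝ} (hε : 0 < ε)
    (hε8 : 8 * ((n : ℝ) + 1) * √ε ≤ 1)
    {V : Finset (EuclideanSpace ℝ (Fin (n + 1)))}
    {E : Finset (Sym2 (EuclideanSpace ℝ (Fin (n + 1))))}
    {S : Set (EuclideanSpace ℝ (Fin (n + 1)))} (hN : IsSteinerSpanner ε S V E)
    (hV : ∀ p ∈ V, ∀ i, 0 ≤ p i ∧ p i ≤ 1)
    {a b : EuclideanSpace ℝ (Fin (n + 1))} (ha : a ∈ S) (hb : b ∈ S)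
    (hal : a (Fin.last n) = 0) (hbl : b (Fin.last n) = 1) :
    ∃ u v : EuclideanSpace ℝ (Fin (n + 1)), s(u, v) ∈ E ∧
      u (Fin.last n) < v (Fin.last n) ∧
      ∀ j, |(v j - u j) / (v (Fin.last n) - u (Fin.last n)) - (b j - a j)|
          ≤ 6 * ((n : ℝ) + 1) * √ε ∧
        |u j - u (Fin.last n) * ((v j - u j) / (v (Fin.last n) - u (Fin.last n))) - a j|
          ≤ 8 * ((n : ℝ) + 1) * √ε := by
  obtain ⟨hSV, hE, hpath⟩ := hN
  have hab : a ≠ b := by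
    rintro rfl
    rw [hal] at hbl
    exact zero_ne_one hbl
  have hsq0 : 0 < √ε := Real.sqrt_pos.mpr hε
  have hn0 : (0 : ℝ) ≤ n := n.cast_nonneg
  have hε1 : ε ≤ 1 := by
    have h1 : √ε ≤ 1 := by nlinarith
    exact Real.sqrt_le_one.mp h1
  obtain ⟨m, v, h0, hm, hedge, hlen⟩ := hpath a ha b hb
  rw [norm_sub_rev] at hlen
  obtain ⟨i, hi, hstep⟩ := exists_step_mul_norm_le_inner hab h0 hm hlen
  have hs : b - a ≠ 0 := sub_ne_zero.mpr hab.symm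
  have hw : v (i + 1) - v i ≠ 0 := by
    intro h
    exact (hE _ (hedge i hi)).1 (by simpa using (sub_eq_zero.mp h).symm)
  obtain ⟨r, hr, hη⟩ := exists_norm_sub_smul_le_of_mul_norm_le_inner hε hε1 hs hw hstep
  have hcut := (norm_sub_add_norm_sub_le_sum v hi.le).trans hlen
  rw [h0, hm] at hcut
  obtain ⟨t, ht⟩ := exists_norm_sub_smul_le_of_norm_add_norm_le hε hε1 hs
    (by abel : (v i - a) + (b - v i) = b - a) hcut
  have hsj : ∀ j, |b j - a j| ≤ 1 := fun j => by
    have h1 := hV a (hSV ha) j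
    have h2 := hV b (hSV hb) j
    rw [abs_le]
    constructor <;> linarith
  have hsn : ‖b - a‖ ≤ (n : ℝ) + 1 := by
    refine (sq_le_sq₀ (by positivity) (by positivity)).mp ?_
    rw [EuclideanSpace.real_norm_sq_eq]
    have : ∑ j, (b - a) j ^ 2 ≤ ∑ _j : Fin (n + 1), (1 : ℝ) :=
      Finset.sum_le_sum fun j _ => by
        rw [PiLp.sub_apply]
        exact (sq_le_one_iff_abs_le_one _).mpr (hsj j)
    refine this.trans ?_
    simp only [Finset.sum_const, Finset.card_univ, Fintype.card_fin, nsmul_eq_mul, mul_one]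
    push_cast
    nlinarith
  set κ : ℝ := 2 * ((n : ℝ) + 1) * √ε with hκ
  have hκ0 : 0 < κ := by positivity
  have hηj : ∀ j, |v (i + 1) j - v i j - r * (b j - a j)| ≤ κ * r := fun j => by
    have h1 := PiLp.norm_apply_le (v (i + 1) - v i - r • (b - a)) j
    simp only [PiLp.sub_apply, PiLp.smul_apply, smul_eq_mul, Real.norm_eq_abs] at h1
    refine (h1.trans hη).trans ?_
    rw [hκ]
    have : √ε * ‖b - a‖ ≤ √ε * ((n : ℝ) + 1) := by gcongr
    nlinarith
  have htj : ∀ j, |v i j - a j - t * (b j - a j)| ≤ κ / 2 := fun j => by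
    have h1 := PiLp.norm_apply_le (v i - a - t • (b - a)) j
    simp only [PiLp.sub_apply, PiLp.smul_apply, smul_eq_mul, Real.norm_eq_abs] at h1
    refine (h1.trans ht).trans ?_
    rw [hκ]
    have : √ε * ‖b - a‖ ≤ √ε * ((n : ℝ) + 1) := by gcongr
    nlinarith
  have hηl := hηj (Fin.last n)
  have htl := htj (Fin.last n)
  rw [hal, hbl] at hηl htl
  set ul := v i (Fin.last n) with hul
  set wl := v (i + 1) (Fin.last n) - ul with hwl
  have hul01 : 0 ≤ ul ∧ ul ≤ 1 :=
    hV _ ((hE _ (hedge i hi)).2 _ (Sym2.mem_mk_left _ _)) _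
  have hκ4 : κ ≤ 1 / 4 := by rw [hκ]; linarith
  have hwl' : 3 / 4 * r ≤ wl := by
    have := (abs_le.mp hηl).1
    nlinarith
  have hwl0 : 0 < wl := by linarith
  refine ⟨v i, v (i + 1), hedge i hi, by linarith, fun j => ?_⟩
  have hdir : |(v (i + 1) j - v i j) / wl - (b j - a j)| ≤ 3 * κ := by
    have h1 : (v (i + 1) j - v i j) / wl - (b j - a j) =
        ((v (i + 1) j - v i j - r * (b j - a j)) - (b j - a j) * (wl - r * (1 - 0))) / wl := by
      field_simp
      ring
    rw [h1, abs_div, abs_of_pos hwl0, div_le_iff₀ hwl0]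
    have h2 : |(b j - a j) * (wl - r * (1 - 0))| ≤ 1 * (κ * r) := by
      rw [abs_mul]
      exact mul_le_mul (hsj j) hηl (abs_nonneg _) zero_le_one
    have h3 := abs_sub (v (i + 1) j - v i j - r * (b j - a j)) ((b j - a j) * (wl - r * (1 - 0)))
    have h4 := hηj j
    nlinarith
  refine ⟨hdir.trans (by rw [hκ]; linarith), ?_⟩
  set x := (v (i + 1) j - v i j) / wl with hx
  have h1 : v i j - ul * x - a j = (v i j - a j - t * (b j - a j))
      - ul * (x - (b j - a j)) - (b j - a j) * (ul - 0 - t * (1 - 0)) := by ring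
  have h2 : |(b j - a j) * (ul - 0 - t * (1 - 0))| ≤ 1 * (κ / 2) := by
    rw [abs_mul]
    exact mul_le_mul (hsj j) htl (abs_nonneg _) zero_le_one
  have h3 : |ul * (x - (b j - a j))| ≤ 1 * (3 * κ) := by
    rw [abs_mul, abs_of_nonneg hul01.1]
    exact mul_le_mul hul01.2 hdir (abs_nonneg _) zero_le_one
  have h4 := htj j
  rw [h1]
  have : κ / 2 + 1 * (3 * κ) + 1 * (κ / 2) = 8 * ((n : ℝ) + 1) * √ε := by rw [hκ]; ring
  rw [← this]
  refine (abs_sub _ _).trans (add_le_add ((abs_sub _ _).trans (add_le_add h4 h3)) h2)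

/-- The point of the grid at height `c` with integer coordinates `f`. -/
def gridPoint {n : ℕ} (ρ : ℕ) (c : ℝ) (f : Fin n → Fin (ρ + 1)) :
    EuclideanSpace ℝ (Fin (n + 1)) :=
  WithLp.toLp 2 (Fin.snoc (α := fun _ => ℝ) (fun j => (f j : ℝ) / ρ) c)

@[simp]
lemma gridPoint_castSucc {n ρ : ℕ} (c : ℝ) (f : Fin n → Fin (ρ + 1)) (j : Fin n) :
    gridPoint ρ c f j.castSucc = (f j : ℝ) / ρ := by
  simp [gridPoint]

@[simp]
lemma gridPoint_last {n ρ : ℕ} (c : ℝ) (f : Fin n → Fin (ρ + 1)) :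
    gridPoint ρ c f (Fin.last n) = c := by
  simp [gridPoint]

lemma gridPoint_mem_gridSet {n ρ : ℕ} (hρ : 0 < ρ) {c : ℝ} (hc : ∃ z : ℤ, c = (z : ℝ) / ρ)
    (f : Fin n → Fin (ρ + 1)) : gridPoint ρ c f ∈ gridSet (n + 1) ρ c := by
  have hρ' : (0 : ℝ) < ρ := Nat.cast_pos.mpr hρ
  intro i
  induction i using Fin.lastCases with
  | last => simpa using hc
  | cast j =>
    have hle : ((f j : ℕ) : ℝ) ≤ ρ := by exact_mod_cast Nat.lt_succ_iff.mp (f j).2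
    refine ⟨⟨(f j : ℕ), by simp⟩, fun _ => ?_, fun h => ?_⟩
    · rw [gridPoint_castSucc]
      exact ⟨by positivity, (div_le_one hρ').mpr hle⟩
    · have := j.2
      simp at h
      omega

lemma gridSet_subset_range_gridPoint {n ρ : ℕ} (hρ : 0 < ρ) (c : ℝ) :
    gridSet (n + 1) ρ c ⊆ Set.range (gridPoint (n := n) ρ c) := by
  have hρ' : (0 : ℝ) < ρ := Nat.cast_pos.mpr hρ
  intro p hp
  have key : ∀ j : Fin n, ∃ k : Fin (ρ + 1), p j.castSucc = (k : ℝ) / ρ := fun j => by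
    obtain ⟨⟨z, hz⟩, h01, -⟩ := hp j.castSucc
    obtain ⟨h0, h1⟩ := h01 (by simp)
    rw [hz, le_div_iff₀ hρ', zero_mul] at h0
    rw [hz, div_le_one hρ'] at h1
    have h0' : 0 ≤ z := by exact_mod_cast h0
    have h1' : z ≤ ρ := by exact_mod_cast h1
    refine ⟨⟨z.toNat, by omega⟩, ?_⟩
    have : ((z.toNat : ℕ) : ℝ) = z := by exact_mod_cast Int.toNat_of_nonneg h0'
    rw [hz, this]
  choose f hf using key
  refine ⟨f, ?_⟩
  ext i
  induction i using Fin.lastCases with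
  | last => simpa using ((hp (Fin.last n)).2.2 (by simp)).symm
  | cast j => rw [gridPoint_castSucc, hf]

lemma ncard_gridSet_le {n ρ : ℕ} (hρ : 0 < ρ) (c : ℝ) :
    (gridSet (n + 1) ρ c).ncard ≤ (ρ + 1) ^ n := by
  refine (Set.ncard_le_ncard (gridSet_subset_range_gridPoint hρ c) (Set.finite_range _)).trans ?_
  rw [← Set.image_univ]
  refine (Set.ncard_image_le Set.finite_univ).trans ?_
  simp [Set.ncard_univ]

/-- Naturals that agree modulo `8` and whose quotients by `ρ` are close are equal. -/
lemma eq_of_mod_eq_of_abs_div_sub_div_le {ρ k l : ℕ} (hρ : 0 < ρ) {x : ℝ}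
    (h : |(k : ℝ) / ρ - (l : ℝ) / ρ| ≤ x) (hx : x * ρ < 8) (hmod : k % 8 = l % 8) : k = l := by
  have hρ' : (0 : ℝ) < ρ := Nat.cast_pos.mpr hρ
  rw [← sub_div, abs_div, abs_of_pos hρ', div_le_iff₀ hρ'] at h
  have h1 := abs_lt.mp (h.trans_lt hx)
  have h2 : (k : ℝ) < l + 8 := by linarith [h1.2]
  have h3 : (l : ℝ) < k + 8 := by linarith [h1.1]
  have h2' : k < l + 8 := by exact_mod_cast h2
  have h3' : l < k + 8 := by exact_mod_cast h3
  omega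

/-- Every edge serves boundedly many pairs of points on opposite grids. -/
lemma pow_mul_pow_le_card_edges {n : ℕ} {ε : ℝ} (hε : 0 < ε)
    (hε8 : 8 * ((n : ℝ) + 1) * √ε ≤ 1) {ρ : ℕ} (hρ : 0 < ρ)
    (hρε : 4 * ((n : ℝ) + 1) * √ε * ρ ≤ 1)
    {V : Finset (EuclideanSpace ℝ (Fin (n + 1)))}
    {E : Finset (Sym2 (EuclideanSpace ℝ (Fin (n + 1))))}
    (hN : IsSteinerSpanner ε (gridSet (n + 1) ρ 0 ∪ gridSet (n + 1) ρ 1) V E)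
    (hV : ∀ p ∈ V, ∀ i, 0 ≤ p i ∧ p i ≤ 1) :
    (ρ + 1) ^ n * (ρ + 1) ^ n ≤ E.card * (8 ^ n * 8 ^ n) := by
  have hρ' : (ρ : ℝ) ≠ 0 := (Nat.cast_pos.mpr hρ).ne'
  have hex : ∀ q : (Fin n → Fin (ρ + 1)) × (Fin n → Fin (ρ + 1)), _ := fun q =>
    exists_edge_near_endpoints hε hε8 hN hV
      (Or.inl (gridPoint_mem_gridSet hρ ⟨0, by simp⟩ q.1))
      (Or.inr (gridPoint_mem_gridSet hρ ⟨ρ, by simp [hρ']⟩ q.2))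
      (gridPoint_last _ _) (gridPoint_last _ _)
  choose u v hE hlt hest using hex
  let φ : (Fin n → Fin (ρ + 1)) × (Fin n → Fin (ρ + 1)) →
      E × (Fin n → Fin 8) × (Fin n → Fin 8) := fun q =>
    (⟨s(u q, v q), hE q⟩, fun j => Fin.ofNat 8 (q.1 j), fun j => Fin.ofNat 8 (q.2 j))
  have hφ : Function.Injective φ := by
    intro p q hpq
    simp only [φ, Prod.mk.injEq, Subtype.mk.injEq, Sym2.eq_iff] at hpq
    obtain ⟨huv, hm1, hm2⟩ := hpq
    have huv' : u p = u q ∧ v p = v q := by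
      refine huv.resolve_right fun h => ?_
      have h1 := hlt p
      rw [h.1, h.2] at h1
      exact lt_asymm h1 (hlt q)
    have hclose : ∀ j : Fin n, (p.1 j : ℕ) = q.1 j ∧ (p.2 j : ℕ) = q.2 j := fun j => by
      have hp := hest p j.castSucc
      have hq := hest q j.castSucc
      rw [huv'.1, huv'.2] at hp
      simp only [gridPoint_castSucc, abs_le] at hp hq
      obtain ⟨⟨hp1, hp2⟩, hp3, hp4⟩ := hp
      obtain ⟨⟨hq1, hq2⟩, hq3, hq4⟩ := hq
      constructor
      · refine eq_of_mod_eq_of_abs_div_sub_div_le hρ (x := 16 * ((n : ℝ) + 1) * √ε) ?_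
          (by linarith) (by simpa [Fin.ext_iff] using congrFun hm1 j)
        rw [abs_le]
        constructor <;> linarith
      · refine eq_of_mod_eq_of_abs_div_sub_div_le hρ (x := 28 * ((n : ℝ) + 1) * √ε) ?_
          (by linarith) (by simpa [Fin.ext_iff] using congrFun hm2 j)
        rw [abs_le]
        constructor <;> linarith
    exact Prod.ext (funext fun j => Fin.ext (hclose j).1) (funext fun j => Fin.ext (hclose j).2)
  simpa using Fintype.card_le_of_injective φ hφ

-- **Statement 5.** For `d ≥ 2` there is `c_d > 0` such that for all `0 < ε < (8d)⁻²`,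
-- every Euclidean Steiner `(1+ε)`-spanner for the two-grid set `S = S₀ ∪ S₁` whose
-- vertices lie in the unit cube `[0,1]^d` has at least `c_d · ε^{(1−d)/2} · |S|` edges,
-- i.e. its sparsity is at least `c_d · ε^{(1−d)/2}`.
theorem steiner_spanner_sparsity_lower_bound (d : ℕ) (hd : 2 ≤ d) :
    ∃ c : ℝ, 0 < c ∧
      ∀ ε : ℝ, 0 < ε → ε < ((8 * (d : ℝ)) ^ 2)⁻¹ →
      ∀ (V : Finset (EuclideanSpace ℝ (Fin d)))
        (E : Finset (Sym2 (EuclideanSpace ℝ (Fin d)))),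
        IsSteinerSpanner ε
          (gridSet d ⌈1 / (8 * (d : ℝ) * Real.sqrt ε)⌉₊ 0 ∪
            gridSet d ⌈1 / (8 * (d : ℝ) * Real.sqrt ε)⌉₊ 1) V E →
        (∀ p ∈ V, ∀ i : Fin d, 0 ≤ p i ∧ p i ≤ 1) →
        c * ε ^ ((1 - (d : ℝ)) / 2) *
            ((gridSet d ⌈1 / (8 * (d : ℝ) * Real.sqrt ε)⌉₊ 0 ∪
              gridSet d ⌈1 / (8 * (d : ℝ) * Real.sqrt ε)⌉₊ 1).ncard : ℝ) ≤
          (E.card : ℝ) := by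
  obtain ⟨n, rfl⟩ : ∃ n, d = n + 1 := ⟨d - 1, by omega⟩
  refine ⟨(2 * (8 * ((n : ℝ) + 1)) ^ n * (8 ^ n * 8 ^ n))⁻¹, by positivity, ?_⟩
  intro ε hε hεd V E hN hV
  have hsq0 : 0 < √ε := Real.sqrt_pos.mpr hε
  have hn1 : (0 : ℝ) < (n : ℝ) + 1 := by positivity
  push_cast at hεd hN ⊢
  set ρ := ⌈1 / (8 * ((n : ℝ) + 1) * √ε)⌉₊ with hρdef
  have hε8 : 8 * ((n : ℝ) + 1) * √ε ≤ 1 := by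
    refine (sq_le_sq₀ (by positivity) zero_le_one).mp ?_
    rw [mul_pow, Real.sq_sqrt hε.le, one_pow]
    calc (8 * ((n : ℝ) + 1)) ^ 2 * ε
        ≤ (8 * ((n : ℝ) + 1)) ^ 2 * ((8 * ((n : ℝ) + 1)) ^ 2)⁻¹ := by gcongr
      _ = 1 := mul_inv_cancel₀ (by positivity)
  have hρ : 0 < ρ := Nat.ceil_pos.mpr (by positivity)
  have hρle : 1 / (8 * ((n : ℝ) + 1) * √ε) ≤ ρ := Nat.le_ceil _
  have hρlt : (ρ : ℝ) < 1 / (8 * ((n : ℝ) + 1) * √ε) + 1 := Nat.ceil_lt_add_one (by positivity)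
  have hρε : 4 * ((n : ℝ) + 1) * √ε * ρ ≤ 1 := by
    calc 4 * ((n : ℝ) + 1) * √ε * ρ
        ≤ 4 * ((n : ℝ) + 1) * √ε * (1 / (8 * ((n : ℝ) + 1) * √ε) + 1) := by gcongr
      _ = 1 / 2 + 8 * ((n : ℝ) + 1) * √ε / 2 := by field_simp; ring
      _ ≤ 1 := by linarith
  have hcard := pow_mul_pow_le_card_edges hε hε8 hρ hρε hN hV
  have hcard' : ((ρ : ℝ) + 1) ^ n * ((ρ : ℝ) + 1) ^ n ≤ E.card * (8 ^ n * 8 ^ n) := by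
    exact_mod_cast hcard
  have hS : ((gridSet (n + 1) ρ 0 ∪ gridSet (n + 1) ρ 1).ncard : ℝ) ≤ 2 * ((ρ : ℝ) + 1) ^ n := by
    have h1 := (Set.ncard_union_le (gridSet (n + 1) ρ 0) (gridSet (n + 1) ρ 1)).trans
      (add_le_add (ncard_gridSet_le hρ 0) (ncard_gridSet_le hρ 1))
    rw [← two_mul] at h1
    exact_mod_cast h1
  have hpow : ε ^ ((1 - ((n : ℝ) + 1)) / 2) ≤ (8 * ((n : ℝ) + 1)) ^ n * ((ρ : ℝ) + 1) ^ n := by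
    have h1 : ε ^ ((1 - ((n : ℝ) + 1)) / 2) = (1 / √ε) ^ n := by
      rw [one_div, Real.sqrt_eq_rpow, ← Real.rpow_neg hε.le, ← Real.rpow_natCast,
        ← Real.rpow_mul hε.le]
      congr 1
      ring
    rw [h1, ← mul_pow]
    have h2 : 1 / √ε ≤ 8 * ((n : ℝ) + 1) * ((ρ : ℝ) + 1) := by
      calc 1 / √ε = 8 * ((n : ℝ) + 1) * (1 / (8 * ((n : ℝ) + 1) * √ε)) := by field_simp
        _ ≤ 8 * ((n : ℝ) + 1) * ((ρ : ℝ) + 1) := by gcongr; linarith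
    gcongr
  rw [mul_assoc, inv_mul_le_iff₀ (by positivity)]
  calc ε ^ ((1 - ((n : ℝ) + 1)) / 2) *
        ((gridSet (n + 1) ρ 0 ∪ gridSet (n + 1) ρ 1).ncard : ℝ)
      ≤ ((8 * ((n : ℝ) + 1)) ^ n * ((ρ : ℝ) + 1) ^ n) * (2 * ((ρ : ℝ) + 1) ^ n) := by gcongr
    _ = 2 * (8 * ((n : ℝ) + 1)) ^ n * (((ρ : ℝ) + 1) ^ n * ((ρ : ℝ) + 1) ^ n) := by ring
    _ ≤ 2 * (8 * ((n : ℝ) + 1)) ^ n * (E.card * (8 ^ n * 8 ^ n)) := by gcongr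
    _ = 2 * (8 * ((n : ℝ) + 1)) ^ n * (8 ^ n * 8 ^ n) * E.card := by ring


end
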